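/- arXiv:2402.02954 — 2 statements merged into one kernel-verified Lean document; each statement's English description precedes it below -/
import Mathlib

section
/- The optimal history action-values factor through the statistic: in a finite partially observed model equipped with a sufficient statistic (B, b_t, φ, ρ, ω), if o, o' ∈ O_t are both reachable and b_t(o) = b_t(o'), then Q*_t(o,u) = Q*_t(o',u) for every u ∈ U (and hence V*_t(o) = V*_t(o')). -/
open scoped Classical

namespace DecPOMDP

variable {X U Z : Type}

/-- Auxiliary filter, recursing on the (reversed) history. -/
noncomputable def filtAux [Fintype X] (s0 : X → ℝ) (p : X → U → X → Z → ℝ) :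
    List (U × Z) → X → ℝ
  | [], x => s0 x
  | uz :: rest, y => ∑ x, filtAux s0 p rest x * p x uz.1 y uz.2

/-- The policy-independent unnormalized filter `μ`:
`filt s0 p [] = s0` and `filt s0 p (o ++ [(u,z)]) y = ∑ x, filt s0 p o x * p x u y z`. -/
noncomputable def filt [Fintype X] (s0 : X → ℝ) (p : X → U → X → Z → ℝ)
    (o : List (U × Z)) (x : X) : ℝ :=
  filtAux s0 p o.reverse x

/-- A history is reachable if its total filter mass is positive. -/
def reachable [Fintype X] (s0 : X → ℝ) (p : X → U → X → Z → ℝ)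
    (o : List (U × Z)) : Prop :=
  0 < ∑ x, filt s0 p o x

/-- The belief (normalized filter) of a history. -/
noncomputable def bel [Fintype X] (s0 : X → ℝ) (p : X → U → X → Z → ℝ)
    (o : List (U × Z)) (x : X) : ℝ :=
  filt s0 p o x / ∑ x', filt s0 p o x'

/-- Optimal history value with `k` stages to go: `Vstar s0 p r γ (ℓ - t)` is `V*_t`. -/
noncomputable def Vstar [Fintype X] [Fintype U] [Fintype Z] [Nonempty U]
    (s0 : X → ℝ) (p : X → U → X → Z → ℝ) (r : X → U → ℝ) (γ : ℝ) :
    ℕ → List (U × Z) → ℝ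
  | 0, _ => 0
  | k + 1, o =>
    Finset.univ.sup' Finset.univ_nonempty fun u : U =>
      (∑ x, bel s0 p o x * r x u) +
        γ * ∑ z : Z,
          if reachable s0 p (o ++ [(u, z)]) then
            (∑ x, ∑ y, bel s0 p o x * p x u y z) * Vstar s0 p r γ k (o ++ [(u, z)])
          else 0

/-- Optimal history action-value: `Qstar s0 p r γ (ℓ - t - 1)` is `Q*_t` (for `t < ℓ`). -/
noncomputable def Qstar [Fintype X] [Fintype U] [Fintype Z] [Nonempty U]
    (s0 : X → ℝ) (p : X → U → X → Z → ℝ) (r : X → U → ℝ) (γ : ℝ)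
    (k : ℕ) (o : List (U × Z)) (u : U) : ℝ :=
  (∑ x, bel s0 p o x * r x u) +
    γ * ∑ z : Z,
      if reachable s0 p (o ++ [(u, z)]) then
        (∑ x, ∑ y, bel s0 p o x * p x u y z) * Vstar s0 p r γ k (o ++ [(u, z)])
      else 0

/-- The history generated up to stage `t` by policy `π` along observation stream `z`
(`z t` being the observation received at stage `t+1`). -/
def hist (π : List (U × Z) → U) (z : ℕ → Z) : ℕ → List (U × Z)
  | 0 => []
  | t + 1 => hist π z t ++ [(π (hist π z t), z t)]

/-- Extend a finitely indexed stream to `ℕ` (junk beyond `m`). -/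
noncomputable def extend {α : Type} [Nonempty α] (m : ℕ) (f : Fin m → α) (t : ℕ) : α :=
  if h : t < m then f ⟨t, h⟩ else Classical.arbitrary α

/-- Expected discounted return `J(π)`: a finite sum over trajectories
`(x_0, …, x_ℓ, z_1, …, z_ℓ)` of the trajectory probability times the discounted return,
actions being chosen by `π` on the generated histories. -/
noncomputable def Jret [Fintype X] [Fintype U] [Fintype Z] [Nonempty X] [Nonempty Z]
    (s0 : X → ℝ) (p : X → U → X → Z → ℝ) (r : X → U → ℝ) (γ : ℝ) (ℓ : ℕ)
    (π : List (U × Z) → U) : ℝ :=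
  ∑ x : Fin (ℓ + 1) → X, ∑ z : Fin ℓ → Z,
    (s0 (extend (ℓ + 1) x 0) *
        ∏ t ∈ Finset.range ℓ,
          p (extend (ℓ + 1) x t) (π (hist π (extend ℓ z) t))
            (extend (ℓ + 1) x (t + 1)) (extend ℓ z t)) *
      ∑ t ∈ Finset.range ℓ, γ ^ t * r (extend (ℓ + 1) x t) (π (hist π (extend ℓ z) t))

/-- `Pr_π(o_t = o ∧ x_t = xh)`: a finite sum over partial trajectories. -/
noncomputable def PrHS [Fintype X] [Fintype U] [Fintype Z] [Nonempty X] [Nonempty Z]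
    (s0 : X → ℝ) (p : X → U → X → Z → ℝ) (π : List (U × Z) → U)
    (t : ℕ) (o : List (U × Z)) (xh : X) : ℝ :=
  ∑ x : Fin (t + 1) → X, ∑ z : Fin t → Z,
    if hist π (extend t z) t = o ∧ extend (t + 1) x t = xh then
      s0 (extend (t + 1) x 0) *
        ∏ s ∈ Finset.range t,
          p (extend (t + 1) x s) (π (hist π (extend t z) s))
            (extend (t + 1) x (s + 1)) (extend t z s)
    else 0

/-- `Pr_π(o_t = o)`. -/
noncomputable def PrH [Fintype X] [Fintype U] [Fintype Z] [Nonempty X] [Nonempty Z]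
    (s0 : X → ℝ) (p : X → U → X → Z → ℝ) (π : List (U × Z) → U)
    (t : ℕ) (o : List (U × Z)) : ℝ :=
  ∑ xh, PrHS s0 p π t o xh

end DecPOMDP

namespace DecPOMDP

lemma filt_append_singleton [Fintype X] (s0 : X → ℝ) (p : X → U → X → Z → ℝ)
    (o : List (U × Z)) (u : U) (z : Z) (y : X) :
    filt s0 p (o ++ [(u, z)]) y = ∑ x, filt s0 p o x * p x u y z := by
  simp [filt, filtAux]

lemma sum_filt_append_singleton [Fintype X] (s0 : X → ℝ) (p : X → U → X → Z → ℝ)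
    {o : List (U × Z)} (ho : reachable s0 p o) (u : U) (z : Z) :
    ∑ y, filt s0 p (o ++ [(u, z)]) y =
      (∑ x, filt s0 p o x) * ∑ x, ∑ y, bel s0 p o x * p x u y z := by
  have hne : ∑ x, filt s0 p o x ≠ 0 := ne_of_gt ho
  simp only [filt_append_singleton, Finset.mul_sum]
  rw [Finset.sum_comm]
  refine Finset.sum_congr rfl fun x _ => Finset.sum_congr rfl fun y _ => ?_
  rw [bel, ← mul_assoc, mul_div_cancel₀ _ hne]

lemma reachable_append_singleton_iff [Fintype X] (s0 : X → ℝ) (p : X → U → X → Z → ℝ)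
    {o : List (U × Z)} (ho : reachable s0 p o) (u : U) (z : Z) :
    reachable s0 p (o ++ [(u, z)]) ↔ 0 < ∑ x, ∑ y, bel s0 p o x * p x u y z := by
  rw [reachable, sum_filt_append_singleton s0 p ho]
  exact mul_pos_iff_of_pos_left ho

lemma Vstar_succ [Fintype X] [Fintype U] [Fintype Z] [Nonempty U]
    (s0 : X → ℝ) (p : X → U → X → Z → ℝ) (r : X → U → ℝ) (γ : ℝ) (k : ℕ)
    (o : List (U × Z)) :
    Vstar s0 p r γ (k + 1) o =
      Finset.univ.sup' Finset.univ_nonempty (Qstar s0 p r γ k o) := rfl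

/-- Histories with the same expected rewards, observation probabilities and successor values have
the same action-values. -/
lemma Qstar_congr [Fintype X] [Fintype U] [Fintype Z] [Nonempty U]
    {s0 : X → ℝ} {p : X → U → X → Z → ℝ} {r : X → U → ℝ} {γ : ℝ} {k : ℕ}
    {o o' : List (U × Z)} {u : U} (ho : reachable s0 p o) (ho' : reachable s0 p o')
    (hr : ∑ x, bel s0 p o x * r x u = ∑ x, bel s0 p o' x * r x u)
    (hp : ∀ z, ∑ x, ∑ y, bel s0 p o x * p x u y z = ∑ x, ∑ y, bel s0 p o' x * p x u y z)
    (hV : ∀ z, reachable s0 p (o ++ [(u, z)]) → reachable s0 p (o' ++ [(u, z)]) →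
      Vstar s0 p r γ k (o ++ [(u, z)]) = Vstar s0 p r γ k (o' ++ [(u, z)])) :
    Qstar s0 p r γ k o u = Qstar s0 p r γ k o' u := by
  unfold Qstar
  rw [hr]
  congr 2
  refine Finset.sum_congr rfl fun z _ => ?_
  have hiff : reachable s0 p (o ++ [(u, z)]) ↔ reachable s0 p (o' ++ [(u, z)]) := by
    rw [reachable_append_singleton_iff s0 p ho, reachable_append_singleton_iff s0 p ho', hp z]
  by_cases h : reachable s0 p (o ++ [(u, z)])
  · rw [if_pos h, if_pos (hiff.1 h), hp z, hV z h (hiff.1 h)]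
  · rw [if_neg h, if_neg (mt hiff.2 h)]

end DecPOMDP

open DecPOMDP in
/-- The optimal history action-values factor through a sufficient statistic:
if `o, o' ∈ O_t` are both reachable and `b_t o = b_t o'` then
`Q*_t(o,u) = Q*_t(o',u)` for every `u`, and hence `V*_t(o) = V*_t(o')`
(here `Q*_t = Qstar … (ℓ - t - 1)` and `V*_t = Vstar … (ℓ - t)`). -/
theorem stmt4 (X U Z : Type) [Fintype X] [Nonempty X] [Fintype U] [Nonempty U]
    [Fintype Z] [Nonempty Z]
    (s0 : X → ℝ) (hs0 : ∀ x, 0 ≤ s0 x) (hs0sum : ∑ x, s0 x = 1)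
    (p : X → U → X → Z → ℝ) (hp : ∀ x u y z, 0 ≤ p x u y z)
    (hpsum : ∀ x u, ∑ y, ∑ z, p x u y z = 1)
    (r : X → U → ℝ) (γ : ℝ) (hγ0 : 0 ≤ γ) (hγ1 : γ ≤ 1) (ℓ : ℕ)
    (B : Type) (bstat : List (U × Z) → B)
    (φ : B → U → Z → B) (ρ : B → U → ℝ) (ω : B → U → Z → ℝ)
    (hρ : ∀ o : List (U × Z), o.length < ℓ → reachable s0 p o →
      ∀ u, ∑ x, bel s0 p o x * r x u = ρ (bstat o) u)
    (hω : ∀ o : List (U × Z), o.length < ℓ → reachable s0 p o →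
      ∀ u z, ∑ x, ∑ y, bel s0 p o x * p x u y z = ω (bstat o) u z)
    (hφ : ∀ o : List (U × Z), o.length < ℓ → reachable s0 p o →
      ∀ u z, reachable s0 p (o ++ [(u, z)]) →
        bstat (o ++ [(u, z)]) = φ (bstat o) u z)
    (t : ℕ) (ht : t < ℓ) (o o' : List (U × Z))
    (hlen : o.length = t) (hlen' : o'.length = t)
    (hro : reachable s0 p o) (hro' : reachable s0 p o')
    (hb : bstat o = bstat o') :
    (∀ u, Qstar s0 p r γ (ℓ - t - 1) o u = Qstar s0 p r γ (ℓ - t - 1) o' u) ∧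
      Vstar s0 p r γ (ℓ - t) o = Vstar s0 p r γ (ℓ - t) o' := by
  have hQ : ∀ k, (∀ a a' : List (U × Z), a.length + k = ℓ → a'.length + k = ℓ →
        reachable s0 p a → reachable s0 p a' → bstat a = bstat a' →
        Vstar s0 p r γ k a = Vstar s0 p r γ k a') →
      ∀ a a' : List (U × Z), a.length + (k + 1) = ℓ → a'.length + (k + 1) = ℓ →
        reachable s0 p a → reachable s0 p a' → bstat a = bstat a' →
        ∀ u, Qstar s0 p r γ k a u = Qstar s0 p r γ k a' u := by
    intro k hV a a' hl hl' ha ha' hab u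
    have hlt : a.length < ℓ := by omega
    have hlt' : a'.length < ℓ := by omega
    refine Qstar_congr ha ha' ?_ (fun z => ?_) fun z hz hz' => ?_
    · rw [hρ a hlt ha, hρ a' hlt' ha', hab]
    · rw [hω a hlt ha, hω a' hlt' ha', hab]
    · refine hV _ _ ?_ ?_ hz hz' ?_
      · simp; omega
      · simp; omega
      · rw [hφ a hlt ha u z hz, hφ a' hlt' ha' u z hz', hab]
  have hV : ∀ k, ∀ a a' : List (U × Z), a.length + k = ℓ → a'.length + k = ℓ →
      reachable s0 p a → reachable s0 p a' → bstat a = bstat a' →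
      Vstar s0 p r γ k a = Vstar s0 p r γ k a' := by
    intro k
    induction k with
    | zero => intros; rfl
    | succ k ih =>
      intro a a' hl hl' ha ha' hab
      rw [Vstar_succ, Vstar_succ, funext (hQ k ih a a' hl hl' ha ha' hab)]
  exact ⟨hQ _ (hV _) o o' (by omega) (by omega) hro hro' hb,
    hV _ o o' (by omega) (by omega) hro hro' hb⟩
end

section
/- Convexity of the finite-horizon value recursion: each value function V_τ is a convex function on ℝ^{Y_τ}, and for each action a ∈ A and each τ < ℓ the action-value map s ↦ ⟨r_{τ,a}, s⟩ + γ·∑_{z∈Z} V_{τ+1}(s·L_{τ,a,z}) is convex on ℝ^{Y_τ}. -/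
/-- Finite-horizon linear-branching value recursion: `Vrec L r γ k τ s` is the value at
stage `τ` with `k` stages to go, so `V_τ = Vrec L r γ (ℓ - τ) τ` for horizon `ℓ`. -/
noncomputable def Vrec {Y : ℕ → Type} [∀ τ, Fintype (Y τ)] {A Z : Type}
    [Fintype A] [Nonempty A] [Fintype Z]
    (L : (τ : ℕ) → A → Z → Y τ → Y (τ + 1) → ℝ)
    (r : (τ : ℕ) → A → Y τ → ℝ) (γ : ℝ) : (k : ℕ) → (τ : ℕ) → (Y τ → ℝ) → ℝ
  | 0, _, _ => 0
  | k + 1, τ, s =>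
    Finset.univ.sup' Finset.univ_nonempty fun a : A =>
      (∑ y, r τ a y * s y) +
        γ * ∑ z : Z, Vrec L r γ k (τ + 1) (fun y' => ∑ y, s y * L τ a z y y')

theorem convexOn_actionValue {m n Z : Type} [Fintype m] [Fintype Z]
    {γ : ℝ} (hγ : 0 ≤ γ) (c : m → ℝ) (M : Z → m → n → ℝ) {V : (n → ℝ) → ℝ}
    (hV : ConvexOn ℝ Set.univ V) :
    ConvexOn ℝ Set.univ (fun s : m → ℝ =>
      (∑ y, c y * s y) + γ * ∑ z : Z, V (fun y' => ∑ y, s y * M z y y')) := by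
  have hlin : ConvexOn ℝ Set.univ (fun s : m → ℝ => ∑ y, c y * s y) :=
    (dotProductBilin ℝ ℝ c).convexOn convex_univ
  have hbranch (z : Z) :
      ConvexOn ℝ Set.univ (fun s : m → ℝ => V (fun y' => ∑ y, s y * M z y y')) :=
    hV.comp_linearMap (Matrix.vecMulLinear (M z))
  have hsum : ConvexOn ℝ Set.univ
      (fun s : m → ℝ => ∑ z : Z, V (fun y' => ∑ y, s y * M z y y')) :=
    ⟨convex_univ, fun x hx y hy a b ha hb hab => by
      simp only [Finset.smul_sum, ← Finset.sum_add_distrib]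
      exact Finset.sum_le_sum fun z _ => (hbranch z).2 hx hy ha hb hab⟩
  exact hlin.add (hsum.smul hγ)

theorem convexOn_Vrec {Y : ℕ → Type} [∀ τ, Fintype (Y τ)] {A Z : Type}
    [Fintype A] [Nonempty A] [Fintype Z]
    (L : (τ : ℕ) → A → Z → Y τ → Y (τ + 1) → ℝ)
    (r : (τ : ℕ) → A → Y τ → ℝ) {γ : ℝ} (hγ : 0 ≤ γ) (k τ : ℕ) :
    ConvexOn ℝ Set.univ (Vrec L r γ k τ) := by
  induction k generalizing τ with
  | zero => exact convexOn_const 0 convex_univ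
  | succ k ih =>
    refine ⟨convex_univ, fun x hx y hy a b ha hb hab => ?_⟩
    simp only [Vrec]
    refine Finset.sup'_le _ _ fun u hu => ?_
    refine ((convexOn_actionValue hγ (r τ u) (L τ u) (ih (τ + 1))).2 hx hy ha hb hab).trans ?_
    gcongr
    · exact Finset.le_sup' (fun u => (∑ y, r τ u y * x y) +
        γ * ∑ z : Z, Vrec L r γ k (τ + 1) (fun y' => ∑ y, x y * L τ u z y y')) hu
    · exact Finset.le_sup' (fun u => (∑ v, r τ u v * y v) +
        γ * ∑ z : Z, Vrec L r γ k (τ + 1) (fun y' => ∑ v, y v * L τ u z v y')) hu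

theorem stmt8 (Y : ℕ → Type) [∀ τ, Fintype (Y τ)] [∀ τ, Nonempty (Y τ)]
    (A Z : Type) [Fintype A] [Nonempty A] [Fintype Z] [Nonempty Z]
    (ℓ : ℕ) (γ : ℝ) (hγ : 0 ≤ γ)
    (L : (τ : ℕ) → A → Z → Y τ → Y (τ + 1) → ℝ)
    (r : (τ : ℕ) → A → Y τ → ℝ) :
    (∀ τ, τ ≤ ℓ → ConvexOn ℝ Set.univ (Vrec L r γ (ℓ - τ) τ)) ∧
    (∀ τ, τ < ℓ → ∀ a : A, ConvexOn ℝ Set.univ (fun s : Y τ → ℝ =>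
      (∑ y, r τ a y * s y) +
        γ * ∑ z : Z, Vrec L r γ (ℓ - (τ + 1)) (τ + 1)
          (fun y' => ∑ y, s y * L τ a z y y'))) := by
  exact ⟨fun τ _ => convexOn_Vrec L r hγ _ τ, fun τ _ a =>
    convexOn_actionValue hγ (r τ a) (L τ a) (convexOn_Vrec L r hγ _ (τ + 1))⟩
end
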